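/- Let E be a real inner product space, F : E →ₗ[ℝ] E a linear map satisfying ⟨F x, y⟩ = −⟨x, F y⟩ for all x, y ∈ E, and assume ‖F x‖ ≤ M ‖x‖ for all x ∈ E, where M ≥ 0. Let p ≥ 1 be an integer and t ≥ 0 with t·M ≤ 1. Then for all x ∈ E, ‖Σ_{i=0}^{2p} (t^i / i!) F^[i] x‖ ≤ (1 + C_p (tM)^{2p+2}) ‖x‖, where C_p = (1/2) Σ_{ℓ=p+1}^{2p} |S_ℓ| and S_ℓ = Σ_{j=−(2p−ℓ)}^{2p−ℓ} (−1)^j / ((ℓ−j)! · (ℓ+j)!). -/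

import Mathlib

open RealInnerProductSpace

/-- The coefficients of `exp (-X) * exp X` vanish in positive degree. -/
lemma sum_antidiagonal_neg_one_pow_div_factorial {n : ℕ} (hn : n ≠ 0) :
    ∑ m ∈ Finset.HasAntidiagonal.antidiagonal n,
      (-1 : ℝ) ^ m.1 * (1 / (m.1.factorial : ℝ)) * (1 / (m.2.factorial : ℝ)) = 0 := by
  have h := (Commute.all (-1 : ℝ) 1).add_pow' n
  rw [neg_add_cancel, zero_pow hn] at h
  have hfac : (n.factorial : ℝ) ≠ 0 := by positivity
  apply mul_left_cancel₀ hfac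
  rw [mul_zero, h, Finset.mul_sum]
  refine Finset.sum_congr rfl fun m hm => ?_
  rw [Finset.HasAntidiagonal.mem_antidiagonal] at hm
  subst hm
  rw [← Nat.add_choose_mul_factorial_mul_factorial m.1 m.2]
  push_cast
  rw [nsmul_eq_mul]
  field_simp
  simpa using Nat.choose_symm_add.symm

/-- The coefficient of degree `s` in the product of the Taylor polynomials of degree `n` of
`exp (-X)` and `exp X`. -/
noncomputable def truncatedExpCoeff (n s : ℕ) : ℝ :=
  ∑ m ∈ (Finset.range (n + 1) ×ˢ Finset.range (n + 1)).filter (fun m => m.1 + m.2 = s),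
    (-1 : ℝ) ^ m.1 * (1 / (m.1.factorial : ℝ)) * (1 / (m.2.factorial : ℝ))

lemma truncatedExpCoeff_zero (n : ℕ) : truncatedExpCoeff n 0 = 1 := by
  have h : (Finset.range (n + 1) ×ˢ Finset.range (n + 1)).filter (fun m => m.1 + m.2 = 0)
      = {(0, 0)} := by
    ext ⟨a, b⟩
    simp only [Finset.mem_filter, Finset.mem_product, Finset.mem_range, Finset.mem_singleton,
      Prod.mk.injEq]
    omega
  rw [truncatedExpCoeff, h]
  simp

lemma truncatedExpCoeff_eq_zero {n s : ℕ} (hs : s ≠ 0) (hsn : s ≤ n) :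
    truncatedExpCoeff n s = 0 := by
  have h : (Finset.range (n + 1) ×ˢ Finset.range (n + 1)).filter (fun m => m.1 + m.2 = s)
      = Finset.HasAntidiagonal.antidiagonal s := by
    ext ⟨a, b⟩
    simp only [Finset.mem_filter, Finset.mem_product, Finset.mem_range, Finset.HasAntidiagonal.mem_antidiagonal]
    omega
  rw [truncatedExpCoeff, h, sum_antidiagonal_neg_one_pow_div_factorial hs]

lemma truncatedExpCoeff_two_mul {n l : ℕ} (hnl : n ≤ 2 * l) :
    truncatedExpCoeff n (2 * l) = (-1) ^ l *
      ∑ j ∈ Finset.Icc (-(n - l : ℤ)) (n - l : ℤ), (-1 : ℝ) ^ j /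
        ((((l : ℤ) - j).toNat.factorial : ℝ) * (((l : ℤ) + j).toNat.factorial : ℝ)) := by
  rw [truncatedExpCoeff, Finset.mul_sum]
  refine Finset.sum_nbij' (fun m => (l : ℤ) - m.1)
    (fun j => (((l : ℤ) - j).toNat, ((l : ℤ) + j).toNat)) ?_ ?_ ?_ ?_ ?_
  · rintro ⟨a, b⟩ h
    simp only [Finset.mem_filter, Finset.mem_product, Finset.mem_range, Finset.mem_Icc] at h ⊢
    omega
  · intro j h
    simp only [Finset.mem_filter, Finset.mem_product, Finset.mem_range, Finset.mem_Icc] at h ⊢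
    omega
  · rintro ⟨a, b⟩ h
    simp only [Finset.mem_filter, Finset.mem_product, Finset.mem_range, Prod.mk.injEq] at h ⊢
    omega
  · intro j h
    simp only [Finset.mem_Icc] at h ⊢
    omega
  · rintro ⟨a, b⟩ h
    simp only [Finset.mem_filter, Finset.mem_product, Finset.mem_range] at h ⊢
    have ha : ((l : ℤ) - (l - a)).toNat = a := by omega
    have hb : ((l : ℤ) + (l - a)).toNat = b := by omega
    have hsign : (-1 : ℝ) ^ l * (-1) ^ ((l : ℤ) - a) = (-1) ^ a := by
      rw [zpow_sub₀ (by norm_num), zpow_natCast, zpow_natCast, ← mul_div_assoc, ← mul_pow,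
        neg_one_mul, neg_neg, one_pow, one_div, ← inv_pow, inv_neg_one]
    rw [ha, hb, ← mul_div_assoc ((-1 : ℝ) ^ l), hsign]
    field_simp

section SkewAdjoint

variable {E : Type*} [NormedAddCommGroup E] [InnerProductSpace ℝ E] {F : E →ₗ[ℝ] E}

lemma inner_iterate_left_of_skew (hF : ∀ x y : E, ⟪F x, y⟫ = -⟪x, F y⟫) (i : ℕ) (x y : E) :
    ⟪(⇑F)^[i] x, y⟫ = (-1) ^ i * ⟪x, (⇑F)^[i] y⟫ := by
  induction i generalizing y with
  | zero => simp
  | succ i ih =>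
    rw [Function.iterate_succ_apply', hF, ih, Function.iterate_succ_apply, pow_succ]
    ring

lemma inner_iterate_iterate_of_skew (hF : ∀ x y : E, ⟪F x, y⟫ = -⟪x, F y⟫) (i k : ℕ) (x : E) :
    ⟪(⇑F)^[i] x, (⇑F)^[k] x⟫ = (-1) ^ i * ⟪x, (⇑F)^[i + k] x⟫ := by
  rw [inner_iterate_left_of_skew hF, Function.iterate_add_apply]

lemma inner_iterate_eq_zero_of_odd (hF : ∀ x y : E, ⟪F x, y⟫ = -⟪x, F y⟫) {s : ℕ} (hs : Odd s)
    (x : E) : ⟪x, (⇑F)^[s] x⟫ = 0 := by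
  have h := inner_iterate_left_of_skew hF s x x
  rw [hs.neg_one_pow, real_inner_comm] at h
  linarith

lemma abs_inner_iterate_two_mul (hF : ∀ x y : E, ⟪F x, y⟫ = -⟪x, F y⟫) (l : ℕ) (x : E) :
    |⟪x, (⇑F)^[2 * l] x⟫| = ‖(⇑F)^[l] x‖ ^ 2 := by
  have h := congrArg abs (inner_iterate_iterate_of_skew hF l l x)
  rw [abs_mul, abs_pow, abs_neg, abs_one, one_pow, one_mul, ← two_mul,
    real_inner_self_eq_norm_sq, abs_of_nonneg (sq_nonneg _)] at h
  exact h.symm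

lemma norm_iterate_le_pow_mul {M : ℝ} (hM : 0 ≤ M) (hFM : ∀ x : E, ‖F x‖ ≤ M * ‖x‖) (l : ℕ)
    (x : E) : ‖(⇑F)^[l] x‖ ≤ M ^ l * ‖x‖ := by
  induction l with
  | zero => simp
  | succ l ih =>
    rw [Function.iterate_succ_apply']
    calc ‖F ((⇑F)^[l] x)‖ ≤ M * ‖(⇑F)^[l] x‖ := hFM _
      _ ≤ M * (M ^ l * ‖x‖) := by gcongr
      _ = M ^ (l + 1) * ‖x‖ := by ring

lemma norm_sq_taylor_of_skew (hF : ∀ x y : E, ⟪F x, y⟫ = -⟪x, F y⟫) (n : ℕ) (t : ℝ) (x : E) :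
    ‖∑ i ∈ Finset.range (n + 1), (t ^ i / (i.factorial : ℝ)) • (⇑F)^[i] x‖ ^ 2
      = ∑ s ∈ Finset.range (2 * n + 1),
        t ^ s * ⟪x, (⇑F)^[s] x⟫ * truncatedExpCoeff n s := by
  have hmaps : ∀ m ∈ Finset.range (n + 1) ×ˢ Finset.range (n + 1),
      m.1 + m.2 ∈ Finset.range (2 * n + 1) := by
    intro m hm
    simp only [Finset.mem_product, Finset.mem_range] at hm ⊢
    omega
  simp only [← real_inner_self_eq_norm_sq, sum_inner, inner_sum]
  rw [← Finset.sum_product', ← Finset.sum_fiberwise_of_maps_to hmaps]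
  refine Finset.sum_congr rfl fun s _ => ?_
  rw [truncatedExpCoeff, Finset.mul_sum]
  refine Finset.sum_congr rfl fun m hm => ?_
  obtain rfl := (Finset.mem_filter.mp hm).2
  simp only [real_inner_smul_left, real_inner_smul_right]
  rw [real_inner_comm, inner_iterate_iterate_of_skew hF]
  ring

lemma norm_sq_taylor_of_skew_even (hF : ∀ x y : E, ⟪F x, y⟫ = -⟪x, F y⟫) (p : ℕ) (t : ℝ)
    (x : E) :
    ‖∑ i ∈ Finset.range (2 * p + 1), (t ^ i / (i.factorial : ℝ)) • (⇑F)^[i] x‖ ^ 2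
      = ‖x‖ ^ 2 + ∑ l ∈ Finset.Icc (p + 1) (2 * p),
        t ^ (2 * l) * ⟪x, (⇑F)^[2 * l] x⟫ * truncatedExpCoeff (2 * p) (2 * l) := by
  rw [norm_sq_taylor_of_skew hF, Finset.sum_range_succ']
  simp only [pow_zero, Function.iterate_zero, id_eq, truncatedExpCoeff_zero, mul_one, one_mul,
    real_inner_self_eq_norm_sq]
  rw [add_comm]
  congr 1
  symm
  refine Finset.sum_of_injOn (fun l => 2 * l - 1) ?_ ?_ ?_ ?_
  · intro a ha b hb hab
    simp only [Finset.coe_Icc, Set.mem_Icc] at ha hb hab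
    omega
  · intro a ha
    simp only [Finset.coe_Icc, Set.mem_Icc, Finset.coe_range, Set.mem_Iio] at ha ⊢
    omega
  · intro s hs hs'
    rcases Nat.even_or_odd' (s + 1) with ⟨l, hl | hl⟩
    · have hle : s + 1 ≤ 2 * p := by
        by_contra hlt
        refine hs' ⟨l, ?_, ?_⟩
        · simp only [Finset.mem_range, Finset.coe_Icc, Set.mem_Icc] at hs ⊢
          omega
        · simp only
          omega
      rw [truncatedExpCoeff_eq_zero s.succ_ne_zero hle, mul_zero]
    · rw [inner_iterate_eq_zero_of_odd hF ⟨l, hl⟩, mul_zero, zero_mul]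
  · intro l hl
    have h : 2 * l - 1 + 1 = 2 * l := by
      rw [Finset.mem_Icc] at hl
      omega
    simp only [h]

end SkewAdjoint

/-- Operator form of Theorem 1 of the paper: for a bounded skew-adjoint `F`
with `‖F x‖ ≤ M ‖x‖`, an order-`2p` Taylor scheme amplifies norms by at most
`1 + C_p (tM)^{2p+2}` whenever `tM ≤ 1`. -/
theorem taylor_scheme_stability
    {E : Type*} [NormedAddCommGroup E] [InnerProductSpace ℝ E]
    (F : E →ₗ[ℝ] E) (hF : ∀ x y : E, ⟪F x, y⟫ = -⟪x, F y⟫)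
    (M : ℝ) (hM : 0 ≤ M) (hFM : ∀ x : E, ‖F x‖ ≤ M * ‖x‖)
    (p : ℕ) (hp : 1 ≤ p) (t : ℝ) (ht : 0 ≤ t) (htM : t * M ≤ 1)
    (S : ℕ → ℝ)
    (hS : ∀ ℓ : ℕ, S ℓ = ∑ j ∈ Finset.Icc (-(2 * p - ℓ : ℤ)) (2 * p - ℓ : ℤ),
      (-1 : ℝ) ^ j / ((((ℓ : ℤ) - j).toNat.factorial : ℝ) * (((ℓ : ℤ) + j).toNat.factorial : ℝ)))
    (C : ℝ) (hC : C = (1 / 2) * ∑ ℓ ∈ Finset.Icc (p + 1) (2 * p), |S ℓ|)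
    (x : E) :
    ‖∑ i ∈ Finset.range (2 * p + 1), (t ^ i / (i.factorial : ℝ)) • (⇑F)^[i] x‖
      ≤ (1 + C * (t * M) ^ (2 * p + 2)) * ‖x‖ := by
  have hz : 0 ≤ t * M := mul_nonneg ht hM
  have hC0 : 0 ≤ C := by
    rw [hC]
    positivity
  have hterm : ∀ l ∈ Finset.Icc (p + 1) (2 * p),
      t ^ (2 * l) * ⟪x, (⇑F)^[2 * l] x⟫ * truncatedExpCoeff (2 * p) (2 * l)
        ≤ |S l| * ((t * M) ^ (2 * p + 2) * ‖x‖ ^ 2) := by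
    intro l hl
    rw [Finset.mem_Icc] at hl
    have hcoeff : |truncatedExpCoeff (2 * p) (2 * l)| = |S l| := by
      rw [truncatedExpCoeff_two_mul (by omega), hS l, abs_mul, abs_pow, abs_neg, abs_one,
        one_pow, one_mul]
      push_cast
      rfl
    calc t ^ (2 * l) * ⟪x, (⇑F)^[2 * l] x⟫ * truncatedExpCoeff (2 * p) (2 * l)
        ≤ |t ^ (2 * l) * ⟪x, (⇑F)^[2 * l] x⟫ * truncatedExpCoeff (2 * p) (2 * l)| := le_abs_self _
      _ = |S l| * (t ^ (2 * l) * ‖(⇑F)^[l] x‖ ^ 2) := by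
        rw [abs_mul, abs_mul, hcoeff, abs_inner_iterate_two_mul hF, abs_pow, abs_of_nonneg ht]
        ring
      _ ≤ |S l| * (t ^ (2 * l) * (M ^ l * ‖x‖) ^ 2) := by
        gcongr
        exact norm_iterate_le_pow_mul hM hFM l x
      _ = |S l| * ((t * M) ^ (2 * l) * ‖x‖ ^ 2) := by ring
      _ ≤ |S l| * ((t * M) ^ (2 * p + 2) * ‖x‖ ^ 2) := by
        gcongr ?_ * (?_ * ?_)
        exact pow_le_pow_of_le_one hz htM (by omega)
  refine (sq_le_sq₀ (norm_nonneg _) (by positivity)).mp ?_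
  rw [norm_sq_taylor_of_skew_even hF]
  calc _ ≤ ‖x‖ ^ 2 + ∑ l ∈ Finset.Icc (p + 1) (2 * p),
        |S l| * ((t * M) ^ (2 * p + 2) * ‖x‖ ^ 2) := by
        exact add_le_add_right (Finset.sum_le_sum hterm) _
    _ = (1 + 2 * (C * (t * M) ^ (2 * p + 2))) * ‖x‖ ^ 2 := by
        rw [← Finset.sum_mul, hC]
        ring
    _ ≤ (1 + C * (t * M) ^ (2 * p + 2)) ^ 2 * ‖x‖ ^ 2 := by
        gcongr
        nlinarith [sq_nonneg (C * (t * M) ^ (2 * p + 2))]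
    _ = ((1 + C * (t * M) ^ (2 * p + 2)) * ‖x‖) ^ 2 := by ring
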